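/- Let (V, ⟨·,·⟩, J) be a complex model, let A : V → V be a nonzero skew-symmetric endomorphism, let τ ∈ {−1, 1} and κ ∈ ℝ, and suppose the algebraic curvature tensor R = κ·R_1 + τ·R_A satisfies the Kähler symmetry R(x,y)z = R(Jx,Jy)z for all x,y,z ∈ V. If A∘J = −J∘A, then for every unit vector x ∈ V one has κ·⟨Ax, Ax⟩ = τ·⟨Ax, Ax⟩²; in particular κ ≠ 0. -/

import Mathlib

open scoped InnerProductSpace

/-- **Lemma 4.5.** Let `(V, ⟪·,·⟫, J)` be a complex model, `A : V → V` a nonzero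
skew-symmetric endomorphism, `τ ∈ {-1,1}`, `κ ∈ ℝ`, and suppose the algebraic curvature
tensor `R = κ R₁ + τ R_A` satisfies the Kähler symmetry `R(x,y)z = R(Jx,Jy)z`.
If `A ∘ J = -J ∘ A`, then for every unit vector `x`,
`κ ⟪Ax, Ax⟫ = τ ⟪Ax, Ax⟫²`; in particular `κ ≠ 0`. -/
theorem anticommuting_case_kappa_nonzero
    {V : Type*} [NormedAddCommGroup V] [InnerProductSpace ℝ V] [FiniteDimensional ℝ V]
    (J : V →ₗ[ℝ] V)
    (hJorth : ∀ x y : V, ⟪J x, J y⟫_ℝ = ⟪x, y⟫_ℝ)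
    (hJ2 : ∀ x : V, J (J x) = -x)
    (A : V →ₗ[ℝ] V) (hA0 : A ≠ 0)
    (hA : ∀ x y : V, ⟪A x, y⟫_ℝ = -⟪x, A y⟫_ℝ)
    (τ : ℝ) (hτ : τ = -1 ∨ τ = 1) (κ : ℝ)
    (R : V → V → V → V)
    (hR : ∀ x y z : V, R x y z = κ • (⟪y, z⟫_ℝ • x - ⟪x, z⟫_ℝ • y) +
      τ • ((2 * ⟪x, A y⟫_ℝ) • A z + ⟪x, A z⟫_ℝ • A y - ⟪y, A z⟫_ℝ • A x))
    (hkahler : ∀ x y z : V, R x y z = R (J x) (J y) z)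
    (hanti : ∀ v : V, A (J v) = -(J (A v))) :
    (∀ x : V, ‖x‖ = 1 → κ * ⟪A x, A x⟫_ℝ = τ * ⟪A x, A x⟫_ℝ ^ 2) ∧ κ ≠ 0 := by
  have hJ : ∀ u v : V, ⟪J u, v⟫_ℝ = -⟪u, J v⟫_ℝ := fun u v => by
    rw [← hJorth u (J v), hJ2, inner_neg_right, neg_neg]
  have hJself : ∀ u : V, ⟪u, J u⟫_ℝ = 0 := fun u => by
    linarith [hJ u u, real_inner_comm u (J u)]
  have hJA : ∀ u : V, ⟪J u, A u⟫_ℝ = 0 := fun u => by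
    have h₁ := hA (J u) u
    rw [hanti, inner_neg_left] at h₁
    linarith [hJ (A u) u, real_inner_comm (A u) (J u)]
  -- the Kähler symmetry at `(x, J A x)`, applied to `J A x` and paired with `x`
  have key : ∀ x : V, κ * ⟪x, x⟫_ℝ * ⟪A x, A x⟫_ℝ = τ * ⟪A x, A x⟫_ℝ ^ 2 := fun x => by
    have hAAx : ⟪A (A x), x⟫_ℝ = -⟪A x, A x⟫_ℝ := hA (A x) x
    have hAx : ⟪A x, x⟫_ℝ = 0 := by linarith [hA x x, real_inner_comm x (A x)]
    have hxJA : ⟪x, J (A x)⟫_ℝ = 0 := by linarith [hJ x (A x), hJA x]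
    have hxJAA : ⟪x, J (A (A x))⟫_ℝ = 0 := by
      have h₁ := hA x (J (A x))
      rw [hanti, inner_neg_right, hJself] at h₁
      linarith
    have hJxAA : ⟪J x, A (A x)⟫_ℝ = 0 := by linarith [hJ x (A (A x))]
    have hAxJAA : ⟪A x, J (A (A x))⟫_ℝ = 0 := by
      linarith [hJ (A x) (A (A x)), hJA (A x)]
    have hxAAx : ⟪x, A (A x)⟫_ℝ = -⟪A x, A x⟫_ℝ := by linarith [hA x (A x)]
    have h := congrArg (fun v => ⟪v, x⟫_ℝ) (hkahler x (J (A x)) (J (A x)))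
    simp only [hR, hanti, hJ2, map_neg, inner_add_left, inner_sub_left, inner_smul_left,
      inner_neg_left, inner_neg_right, hJorth, hxJA, hxJAA, hJxAA, hAxJAA, hAx, hAAx, hxAAx, hJself,
      RCLike.conj_to_real] at h
    linear_combination h
  refine ⟨fun x hx => ?_, fun hκ => hA0 (LinearMap.ext fun x => ?_)⟩
  · simpa [real_inner_self_eq_norm_sq x, hx] using key x
  · have h := (key x).symm
    rcases hτ with rfl | rfl <;> simpa [hκ] using h
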